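/- arXiv:0712.2246 — 2 statements merged into one kernel-verified Lean document; each statement's English description precedes it below -/
import Mathlib

section
/- Let A ∈ M_{d·m}(ℂ) be positive semidefinite. Then there exist a positive semidefinite D ∈ M_d(ℂ) and unitary matrices V_1,…,V_m ∈ U(d·m) such that A = (1/m) Σ_{i=1}^m V_i*(⊕_{j=1}^m δ_{ij}D)V_i, where ⊕_{j=1}^m δ_{ij}D ∈ M_{d·m}(ℂ) denotes the block-diagonal matrix (with respect to the decomposition into m diagonal d×d blocks) whose i-th diagonal block is D and whose other diagonal blocks are zero. In particular, A is (1/m times) a sum of m positive semidefinite matrices, each of rank at most d and each unitarily equivalent to D ⊕ 0_{d(m-1)}. -/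
open Matrix
open scoped ComplexOrder

/-- The `i`-th coordinate projection of `M_{d·m}(ℂ)` (matrices indexed by
`Fin m × Fin d`, i.e. `m×m` arrays of `d×d` blocks), of rank `d`. -/
def blockProj {d m : ℕ} (i : Fin m) : Matrix (Fin m × Fin d) (Fin m × Fin d) ℂ :=
  Matrix.diagonal fun p => if p.1 = i then 1 else 0

/-- The compression `C_P(X) = Σ_i P_i X P_i` onto the block diagonal part. -/
noncomputable def blockCompress {d m : ℕ}
    (X : Matrix (Fin m × Fin d) (Fin m × Fin d) ℂ) :
    Matrix (Fin m × Fin d) (Fin m × Fin d) ℂ :=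
  ∑ i : Fin m, blockProj i * X * blockProj i

/-- The block-diagonal matrix `⊕_{j=1}^m δ_{ij} D ∈ M_{d·m}(ℂ)` whose `i`-th
diagonal `d×d` block is `D` and whose other blocks vanish. -/
noncomputable def deltaBlock {d m : ℕ} (i : Fin m) (D : Matrix (Fin d) (Fin d) ℂ) :
    Matrix (Fin m × Fin d) (Fin m × Fin d) ℂ :=
  Matrix.of fun p q => if p.1 = i ∧ q.1 = i then D p.2 q.2 else 0

/-- Hermitian matrices with the same characteristic polynomial are unitarily equivalent. -/
theorem exists_unitary_conj_of_charpoly_eq {n : Type*} [Fintype n] [DecidableEq n]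
    {A B : Matrix n n ℂ} (hA : A.IsHermitian) (hB : B.IsHermitian)
    (h : A.charpoly = B.charpoly) :
    ∃ V ∈ Matrix.unitaryGroup n ℂ, A = Vᴴ * B * V := by
  have he := (hA.eigenvalues_eq_eigenvalues_iff hB).2 h
  refine ⟨_,
    (hB.eigenvectorUnitary * star hA.eigenvectorUnitary).2, ?_⟩
  have h1 : (hB.eigenvectorUnitary : Matrix n n ℂ)ᴴ * hB.eigenvectorUnitary = 1 :=
    Unitary.coe_star_mul_self hB.eigenvectorUnitary
  have hA' := hA.spectral_theorem
  have hB' := hB.spectral_theorem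
  rw [Unitary.conjStarAlgAut_apply] at hA' hB'
  rw [he] at hA'
  set Λ : Matrix n n ℂ := diagonal (RCLike.ofReal ∘ hB.eigenvalues)
  set U : Matrix n n ℂ := (hA.eigenvectorUnitary).1
  set W : Matrix n n ℂ := (hB.eigenvectorUnitary).1
  change A = U * Λ * Uᴴ at hA'
  change B = W * Λ * Wᴴ at hB'
  change A = (W * Uᴴ)ᴴ * B * (W * Uᴴ)
  rw [hA', hB', conjTranspose_mul, conjTranspose_conjTranspose]
  calc U * Λ * Uᴴ = U * (Wᴴ * W) * Λ * (Wᴴ * W) * Uᴴ := by simp [h1]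
    _ = _ := by simp only [Matrix.mul_assoc]

/-- For `Z` square, `Z Zᴴ` and `Zᴴ Z` are unitarily equivalent. -/
theorem exists_unitary_mul_conjTranspose {n : Type*} [Fintype n] [DecidableEq n]
    (Z : Matrix n n ℂ) :
    ∃ V ∈ Matrix.unitaryGroup n ℂ, Z * Zᴴ = Vᴴ * (Zᴴ * Z) * V :=
  exists_unitary_conj_of_charpoly_eq (isHermitian_mul_conjTranspose_self Z)
    (isHermitian_conjTranspose_mul_self Z) (charpoly_mul_comm _ _)

/-- A Fourier matrix: entries of modulus one and orthogonal rows. -/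
theorem exists_unimodular_orthogonal_rows (m : ℕ) :
    ∃ G : Fin m → Fin m → ℂ, (∀ k i, star (G k i) * G k i = 1) ∧
      ∀ k l, ∑ i, G k i * star (G l i) = if k = l then (m : ℂ) else 0 := by
  cases m with
  | zero => exact ⟨fun _ _ => 0, fun k => k.elim0, fun k => k.elim0⟩
  | succ n =>
    suffices H : ∃ G : ZMod (n + 1) → ZMod (n + 1) → ℂ, (∀ k i, star (G k i) * G k i = 1) ∧
        ∀ k l, ∑ i, G k i * star (G l i) = if k = l then ((n + 1 : ℕ) : ℂ) else 0 from H
    refine ⟨fun k i => ZMod.stdAddChar (i * k), fun k i => ?_, fun k l => ?_⟩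
    · rw [← starRingEnd_apply, ← AddChar.map_neg_eq_conj, ← AddChar.map_add_eq_mul,
        neg_add_cancel, AddChar.map_zero_eq_one]
    · simp_rw [← starRingEnd_apply, ← AddChar.map_neg_eq_conj, ← AddChar.map_add_eq_mul,
        ← mul_neg, ← mul_add, ← sub_eq_add_neg]
      rw [AddChar.sum_mulShift _ (ZMod.isPrimitive_stdAddChar (n + 1)), ZMod.card]
      simp only [sub_eq_zero, Nat.cast_ite, Nat.cast_zero]

/-- A nonnegative diagonal matrix is an average of matrices `Y i * (Y i)ᴴ` for which
`(Y i)ᴴ * Y i` is supported on the `i`-th diagonal block, with the same block for each `i`. -/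
theorem exists_sum_mul_conjTranspose_eq_diagonal {d m : ℕ} (ev : Fin m × Fin d → ℝ)
    (hev : ∀ p, 0 ≤ ev p) :
    ∃ D : Matrix (Fin d) (Fin d) ℂ, D.PosSemidef ∧
      ∃ Y : Fin m → Matrix (Fin m × Fin d) (Fin m × Fin d) ℂ,
        (∀ i, (Y i)ᴴ * Y i = deltaBlock i D) ∧
        ∑ i, Y i * (Y i)ᴴ = (m : ℂ) • diagonal fun p => (ev p : ℂ) := by
  obtain ⟨G, hG1, hG2⟩ := exists_unimodular_orthogonal_rows m
  have hsq (p) : ((√(ev p) : ℝ) : ℂ) * (√(ev p) : ℝ) = ev p := by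
    rw [← Complex.ofReal_mul, Real.mul_self_sqrt (hev p)]
  have hstar (x : ℝ) : star (x : ℂ) = x := Complex.conj_ofReal x
  refine ⟨diagonal fun b => ∑ k, (ev (k, b) : ℂ), ?_, fun i => of fun p q =>
    if q.1 = i ∧ p.2 = q.2 then (√(ev p) : ℝ) * G p.1 i else 0, fun i => ?_, ?_⟩
  · refine PosSemidef.diagonal fun b => Finset.sum_nonneg fun k _ => ?_
    exact Complex.zero_le_real.2 (hev _)
  · ext ⟨j, b⟩ ⟨j', b'⟩
    simp only [mul_apply, conjTranspose_apply, of_apply, deltaBlock, diagonal_apply,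
      Fintype.sum_prod_type]
    by_cases hj : j = i
    · by_cases hj' : j' = i
      · by_cases hb : b = b'
        · subst hb
          simp only [hj, hj', true_and, and_self, if_true]
          refine Finset.sum_congr rfl fun k _ => ?_
          rw [Finset.sum_eq_single b (by intro c _ hc; simp [hc]) (by simp)]
          simp only [if_true, star_mul', hstar]
          rw [← hsq]
          linear_combination (√(ev (k, b)) : ℂ) * √(ev (k, b)) * hG1 k i
        · simp only [hj, hj', true_and, and_self, if_true, hb, if_false]
          refine Finset.sum_eq_zero fun k _ => Finset.sum_eq_zero fun c _ => ?_
          by_cases hc : c = b <;> simp [hc, hb]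
      · simp [hj']
    · simp [hj]
  · ext ⟨k, a⟩ ⟨l, c⟩
    have key (i : Fin m) : ∑ x : Fin m, ∑ y : Fin d,
        (if x = i ∧ a = y then ((√(ev (k, a)) : ℝ) : ℂ) * G k i else 0) *
          star (if x = i ∧ c = y then ((√(ev (l, c)) : ℝ) : ℂ) * G l i else 0) =
        (if a = c then ((√(ev (k, a)) : ℝ) : ℂ) * (√(ev (l, c)) : ℝ) else 0) *
          (G k i * star (G l i)) := by
      rw [Finset.sum_eq_single i (by intro x _ hx; simp [hx]) (by simp),
        Finset.sum_eq_single a (by intro y _ hy; simp [hy.symm]) (by simp)]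
      by_cases hac : a = c
      · simp only [hac, and_self, if_true, star_mul', hstar]
        ring
      · simp [hac, Ne.symm hac]
    simp only [Matrix.sum_apply, mul_apply, conjTranspose_apply, of_apply, Fintype.sum_prod_type,
      Matrix.smul_apply, diagonal_apply, smul_eq_mul, key, ← Finset.mul_sum, hG2, Prod.mk.injEq]
    by_cases hac : a = c
    · by_cases hkl : k = l
      · subst hac hkl
        simp [← hsq, mul_comm]
      · simp [hkl]
    · simp [hac]

theorem rank_deltaBlock_le {d m : ℕ} (i : Fin m) (D : Matrix (Fin d) (Fin d) ℂ) :
    (deltaBlock i D).rank ≤ d := by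
  have h : deltaBlock i D =
      (of fun (p : Fin m × Fin d) b => if p.1 = i then D p.2 b else 0) *
        of fun b (q : Fin m × Fin d) => if q.1 = i ∧ b = q.2 then (1 : ℂ) else 0 := by
    ext p q
    by_cases hq : q.1 = i <;> simp [deltaBlock, mul_apply, hq]
  rw [h]
  exact (rank_mul_le_left _ _).trans ((rank_le_card_width _).trans_eq (Fintype.card_fin d))

/-- a non-commutative Horn lemma, second part: every
positive semidefinite `A ∈ M_{d·m}(ℂ)` is `(1/m)` times a sum of `m` matrices
`V_i*(⊕_j δ_{ij} D)V_i` with `V_i` unitary and `D ∈ M_d(ℂ)` positive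
semidefinite; in particular each summand is positive semidefinite of rank at
most `d` (being unitarily equivalent to `D ⊕ 0`). -/
theorem stmt_18 {d m : ℕ} (A : Matrix (Fin m × Fin d) (Fin m × Fin d) ℂ)
    (hA : A.PosSemidef) :
    ∃ D : Matrix (Fin d) (Fin d) ℂ, D.PosSemidef ∧
      ∃ V : Fin m → Matrix (Fin m × Fin d) (Fin m × Fin d) ℂ,
        (∀ i, V i ∈ Matrix.unitaryGroup (Fin m × Fin d) ℂ) ∧
        A = (m : ℂ)⁻¹ • ∑ i : Fin m, (V i)ᴴ * deltaBlock i D * V i ∧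
        ∀ i, ((V i)ᴴ * deltaBlock i D * V i).PosSemidef ∧
          ((V i)ᴴ * deltaBlock i D * V i).rank ≤ d := by
  obtain ⟨D, hD, Y, hY1, hY2⟩ :=
    exists_sum_mul_conjTranspose_eq_diagonal hA.1.eigenvalues hA.eigenvalues_nonneg
  have hU : hA.1.eigenvectorUnitary.1ᴴ * hA.1.eigenvectorUnitary.1 = 1 :=
    Unitary.coe_star_mul_self hA.1.eigenvectorUnitary
  have hA' := hA.1.spectral_theorem
  rw [Unitary.conjStarAlgAut_apply] at hA'
  set U : Matrix (Fin m × Fin d) (Fin m × Fin d) ℂ := hA.1.eigenvectorUnitary.1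
  have hZ (i : Fin m) : (U * Y i)ᴴ * (U * Y i) = deltaBlock i D := by
    rw [← hY1, conjTranspose_mul, Matrix.mul_assoc, ← Matrix.mul_assoc Uᴴ, hU, Matrix.one_mul]
  choose V hV hVZ using fun i => exists_unitary_mul_conjTranspose (U * Y i)
  simp only [hZ] at hVZ
  refine ⟨D, hD, V, hV, ?_, fun i => ⟨?_, ?_⟩⟩
  · rcases Nat.eq_zero_or_pos m with rfl | hm
    · exact Subsingleton.elim _ _
    have hm' : (m : ℂ) ≠ 0 := by exact_mod_cast hm.ne'
    have hsum : ∑ i, (V i)ᴴ * deltaBlock i D * V i = (m : ℂ) • A := by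
      calc ∑ i, (V i)ᴴ * deltaBlock i D * V i = U * (∑ i, Y i * (Y i)ᴴ) * Uᴴ := by
            simp only [← hVZ, conjTranspose_mul, Matrix.mul_sum, Matrix.sum_mul, Matrix.mul_assoc]
        _ = (m : ℂ) • A := by
            rw [hY2, Matrix.mul_smul, Matrix.smul_mul]
            exact congrArg _ hA'.symm
    rw [hsum, inv_smul_smul₀ hm']
  · rw [← hVZ]
    exact posSemidef_self_mul_conjTranspose _
  · exact ((rank_mul_le_left _ _).trans (rank_mul_le_right _ _)).trans (rank_deltaBlock_le i D)
end

section
/- Let a = (a_1,…,a_n) and b = (b_1,…,b_n) be vectors in ℝ^n with nonnegative entries. Then there exist rank-one orthogonal projections Q_1,…,Q_n ∈ M_n(ℂ) such that Diag(b) = Σ_{i=1}^n a_i Q_i if and only if a ≺ b. -/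
open Matrix
open scoped ComplexOrder

/-- `V` is a contraction: its operator norm on `ℓ²` is at most 1. -/
noncomputable def IsContraction {ι : Type*} [Fintype ι] [DecidableEq ι]
    (V : Matrix ι ι ℂ) : Prop :=
  ∀ x : EuclideanSpace ℂ ι, ‖Matrix.toEuclideanLin V x‖ ≤ ‖x‖

/-- The `i`-th coordinate projection of the system encoded by the block-index
function `g : Fin n → Fin m` (monotone and surjective `g` corresponds to a
partition of `{1,…,n}` into `m` consecutive intervals). -/
def coordProj {n m : ℕ} (g : Fin n → Fin m) (i : Fin m) :
    Matrix (Fin n) (Fin n) ℂ :=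
  Matrix.diagonal fun k => if g k = i then 1 else 0

/-- The compression `C_P(X) = Σ_i P_i X P_i` induced by the system of
coordinate projections encoded by `g`. -/
noncomputable def coordCompress {n m : ℕ} (g : Fin n → Fin m)
    (X : Matrix (Fin n) (Fin n) ℂ) : Matrix (Fin n) (Fin n) ℂ :=
  ∑ i : Fin m, coordProj g i * X * coordProj g i

/-- The nonincreasing rearrangement `x↓` of a vector `x ∈ ℝ^n`. -/
noncomputable def sortedVec {n : ℕ} (x : Fin n → ℝ) : Fin n → ℝ :=
  fun i => ((Multiset.map x Finset.univ.val).sort (· ≥ ·)).get (Fin.cast (by simp) i)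

/-- Vector majorization `x ≺ y`. -/
noncomputable def Majorizes {n : ℕ} (x y : Fin n → ℝ) : Prop :=
  (∀ k : ℕ, k ≤ n →
      ∑ i ∈ Finset.univ.filter (fun i : Fin n => (i : ℕ) < k), sortedVec x i ≤
        ∑ i ∈ Finset.univ.filter (fun i : Fin n => (i : ℕ) < k), sortedVec y i) ∧
    ∑ i, x i = ∑ i, y i

/-- `f(A)` for a hermitian matrix `A`, via the spectral theorem. -/
noncomputable def matFun {n : ℕ} {A : Matrix (Fin n) (Fin n) ℂ}
    (hA : A.IsHermitian) (f : ℝ → ℝ) : Matrix (Fin n) (Fin n) ℂ :=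
  (hA.eigenvectorUnitary : Matrix (Fin n) (Fin n) ℂ) *
    Matrix.diagonal (fun i => (f (hA.eigenvalues i) : ℂ)) *
    star (hA.eigenvectorUnitary : Matrix (Fin n) (Fin n) ℂ)

theorem sortedVec_antitone {n : ℕ} (x : Fin n → ℝ) : Antitone (sortedVec x) := by
  intro i j hij
  unfold sortedVec
  have := (Multiset.pairwise_sort (Multiset.map x Finset.univ.val) (· ≥ ·))
  rcases hij.eq_or_lt with rfl | h
  · rfl
  · exact List.pairwise_iff_get.1 this _ _ (by simpa using h)

theorem sum_mul_le_partial_sum {n : ℕ} (s t : Fin n → ℝ) (k : ℕ) (hk : k ≤ n) (hs : Antitone s)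
    (hs0 : ∀ i, 0 ≤ s i) (ht0 : ∀ i, 0 ≤ t i) (ht1 : ∀ i, t i ≤ 1) (ht : ∑ i, t i ≤ k) :
    ∑ i, s i * t i ≤ ∑ i ∈ Finset.univ.filter (fun i : Fin n => (i : ℕ) < k), s i := by
  have hcard : (Finset.univ.filter (fun i : Fin n => (i : ℕ) < k)).card = k := by
    simp [Fin.card_filter_val_lt, hk]
  obtain ⟨c, hc0, hlt, hge⟩ : ∃ c : ℝ, 0 ≤ c ∧ (∀ i : Fin n, (i : ℕ) < k → c ≤ s i) ∧
      ∀ i : Fin n, k ≤ (i : ℕ) → s i ≤ c := by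
    rcases hk.lt_or_eq with h | rfl
    · exact ⟨s ⟨k, h⟩, hs0 _, fun i hi => hs (Fin.mk_le_mk.2 hi.le),
        fun i hi => hs (Fin.mk_le_mk.2 hi)⟩
    · exact ⟨0, le_rfl, fun i _ => hs0 i, fun i hi => absurd i.2 (by omega)⟩
  have key : ∑ i, (s i * t i - if (i : ℕ) < k then s i else 0) ≤
      ∑ i : Fin n, c * (t i - if (i : ℕ) < k then 1 else 0) := by
    refine Finset.sum_le_sum fun i _ => ?_
    split_ifs with h
    · nlinarith [hlt i h, ht1 i]
    · nlinarith [hge i (by omega), ht0 i]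
  rw [← Finset.mul_sum, Finset.sum_sub_distrib, Finset.sum_sub_distrib, ← Finset.sum_filter,
    ← Finset.sum_filter, Finset.sum_const, hcard] at key
  simp only [nsmul_eq_mul, mul_one] at key
  nlinarith

theorem exists_perm_sortedVec {n : ℕ} (x : Fin n → ℝ) :
    ∃ σ : Equiv.Perm (Fin n), ∀ i, sortedVec x i = x (σ i) := by
  have h : (List.ofFn (sortedVec x)).Perm (List.ofFn x) := by
    have h1 : List.ofFn (sortedVec x) = (Multiset.map x Finset.univ.val).sort (· ≥ ·) := by
      apply List.ext_get <;> simp [sortedVec]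
    rw [h1, ← Multiset.coe_eq_coe, Multiset.sort_eq, Fin.univ_val_map]
  have hanti : Antitone (x ∘ Tuple.sort (OrderDual.toDual ∘ x)) :=
    Tuple.monotone_sort (OrderDual.toDual ∘ x)
  refine ⟨Tuple.sort (OrderDual.toDual ∘ x), fun i => ?_⟩
  have h2 := h.trans (Equiv.Perm.ofFn_comp_perm (Tuple.sort (OrderDual.toDual ∘ x)) x).symm
  have h3 := h2.eq_of_pairwise' (r := (· ≥ ·))
    (List.sortedGE_ofFn_iff.2 (sortedVec_antitone x)).pairwise
    (List.sortedGE_ofFn_iff.2 hanti).pairwise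
  exact congrFun (List.ofFn_injective h3) i

theorem exists_eq_vecMulVec_of_rank_one {n : ℕ} (Q : Matrix (Fin n) (Fin n) ℂ)
    (hQ : Q.IsHermitian) (hi : Q * Q = Q) (hr : Q.rank = 1) :
    ∃ v : Fin n → ℂ, Q = vecMulVec v (star v) ∧ star v ⬝ᵥ v = 1 := by
  obtain ⟨⟨u, hu⟩, hu0, hspan⟩ := finrank_eq_one_iff'.1 hr
  have hu0 : u ≠ 0 := fun h => hu0 (Subtype.ext h)
  have hQu : Q *ᵥ u = u := by
    obtain ⟨y, rfl⟩ := hu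
    simp [hi]
  have hQs : ∀ x, star u ⬝ᵥ (Q *ᵥ x) = star u ⬝ᵥ x := fun x => by
    rw [dotProduct_mulVec, ← hQ.eq, ← star_mulVec, hQu]
  set N : ℝ := ∑ p, Complex.normSq (u p) with hN
  have hdot : star u ⬝ᵥ u = (N : ℂ) := by
    simp [dotProduct, hN, Complex.normSq_eq_conj_mul_self]
  have hNpos : 0 < N := by
    obtain ⟨p, hp⟩ := Function.ne_iff.1 hu0
    exact Finset.sum_pos' (fun i _ => Complex.normSq_nonneg _)
      ⟨p, Finset.mem_univ _, Complex.normSq_pos.2 hp⟩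
  have hNs : ((√N : ℝ) : ℂ) * (√N : ℝ) = N := by
    rw [← Complex.ofReal_mul, Real.mul_self_sqrt hNpos.le]
  have hs0 : ((√N : ℝ) : ℂ) ≠ 0 := by
    exact_mod_cast (Real.sqrt_pos.2 hNpos).ne'
  have hstar : star (((√N : ℝ) : ℂ)⁻¹ • u) = ((√N : ℝ) : ℂ)⁻¹ • star u := by
    rw [star_smul, star_inv₀, Complex.star_def, Complex.conj_ofReal]
  refine ⟨((√N : ℝ) : ℂ)⁻¹ • u, ?_, ?_⟩
  · rw [hstar]
    refine Matrix.toLin'.injective (LinearMap.ext fun x => ?_)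
    obtain ⟨c, hc⟩ := hspan ⟨Q *ᵥ x, x, rfl⟩
    have hc : c • u = Q *ᵥ x := congrArg Subtype.val hc
    have hcx := hQs x
    rw [← hc, dotProduct_smul, hdot, smul_eq_mul] at hcx
    rw [toLin'_apply, toLin'_apply, vecMulVec_mulVec, ← hc, smul_dotProduct, ← hcx]
    ext p
    simp
    rw [← hNs]
    field_simp
  · rw [hstar, smul_dotProduct, dotProduct_smul, hdot, smul_eq_mul, smul_eq_mul, ← hNs]
    field_simp

theorem exists_rotation {n : ℕ} (M : Matrix (Fin n) (Fin n) ℝ) {j k : Fin n} (hjk : j ≠ k) {t : ℝ}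
    (hkt : M k k ≤ t) (htj : t ≤ M j j) :
    ∃ U : Matrix (Fin n) (Fin n) ℝ, Uᵀ * U = 1 ∧ (Uᵀ * M * U) j j = t ∧
      (Uᵀ * M * U) k k = M j j + M k k - t ∧
      ∀ i, i ≠ j → i ≠ k → (Uᵀ * M * U) i i = M i i := by
  obtain ⟨θ, -, hθ⟩ : t ∈ (fun θ : ℝ => Real.cos θ ^ 2 * M j j +
      Real.cos θ * Real.sin θ * (M j k + M k j) + Real.sin θ ^ 2 * M k k) ''
        Set.Icc 0 (Real.pi / 2) := by
    refine intermediate_value_Icc' (by positivity) (by fun_prop) ?_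
    simpa using ⟨hkt, htj⟩
  have hcs := Real.sin_sq_add_cos_sq θ
  set c := Real.cos θ
  set s := Real.sin θ
  let w : Fin n → Fin n → ℝ := fun i =>
    if i = j then c • Pi.single j 1 + s • Pi.single k 1
    else if i = k then (-s) • Pi.single j 1 + c • Pi.single k 1 else Pi.single i 1
  have hwj : w j = c • Pi.single j 1 + s • Pi.single k 1 := by simp [w]
  have hwk : w k = (-s) • Pi.single j 1 + c • Pi.single k 1 := by simp [w, hjk.symm]
  have hwi : ∀ i, i ≠ j → i ≠ k → w i = Pi.single i 1 := fun i h1 h2 => by simp [w, h1, h2]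
  have hent : ∀ i, ((of w)ᵀᵀ * M * (of w)ᵀ) i i = w i ⬝ᵥ (M *ᵥ w i) := fun i => by
    rw [Matrix.mul_assoc, mul_apply']
    rfl
  refine ⟨(of w)ᵀ, ?_, ?_, ?_, ?_⟩
  · ext p q
    have : ((of w)ᵀᵀ * (of w)ᵀ) p q = w p ⬝ᵥ w q := by rw [mul_apply']; rfl
    rw [this, one_apply]
    have hcases : ∀ i, i = j ∨ i = k ∨ i ≠ j ∧ i ≠ k := by grind
    rcases hcases p with rfl | rfl | ⟨hpj, hpk⟩ <;>
      rcases hcases q with rfl | rfl | ⟨hqj, hqk⟩ <;>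
      simp [*, hjk.symm, Pi.single_apply] <;> grind
  · rw [hent, hwj]
    simp [mulVec_add, mulVec_smul]
    simp at hθ
    linarith
  · rw [hent, hwk]
    simp [mulVec_add, mulVec_smul, mulVec_neg]
    simp at hθ
    linear_combination (M j j + M k k) * hcs - hθ
  · intro i h1 h2
    rw [hent, hwi i h1 h2]
    simp

theorem exists_orthogonal_diag_eq {n : ℕ} (a : Fin n → ℝ) (ha : Antitone a) (N : ℕ) :
    ∀ M : Matrix (Fin n) (Fin n) ℝ, (Finset.univ.filter fun i => a i ≠ M i i).card ≤ N →
      (∀ l : ℕ, ∑ i ∈ Finset.univ.filter (fun i : Fin n => (i : ℕ) < l), a i ≤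
        ∑ i ∈ Finset.univ.filter (fun i : Fin n => (i : ℕ) < l), M i i) →
      ∑ i, a i = ∑ i, M i i →
      ∃ U : Matrix (Fin n) (Fin n) ℝ, Uᵀ * U = 1 ∧ ∀ i, (Uᵀ * M * U) i i = a i := by
  induction N with
  | zero =>
    intro M hc _ _
    refine ⟨1, by simp, fun i => ?_⟩
    have := Finset.card_eq_zero.1 (Nat.le_zero.1 hc)
    simp only [Finset.filter_eq_empty_iff, not_not] at this
    simpa using (this (Finset.mem_univ i)).symm
  | succ N ih =>
    intro M hc hpre htot
    by_cases hall : ∀ i, a i = M i i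
    · exact ⟨1, by simp, fun i => by simpa using (hall i).symm⟩
    have hex : ∃ k, M k k < a k := by
      by_contra! h
      exact hall fun i => (Finset.sum_eq_sum_iff_of_le fun i _ => h i).1 htot i (Finset.mem_univ i)
    obtain ⟨k, hk, hmin⟩ := WellFounded.has_min (wellFounded_lt (α := Fin n))
      {k | M k k < a k} hex
    have hk : M k k < a k := hk
    have hmin : ∀ i < k, a i ≤ M i i := fun i hi => not_lt.1 fun h => hmin i h hi
    obtain ⟨j, hjk, hj⟩ : ∃ j < k, a j < M j j := by
      by_contra! h
      refine (hpre (k + 1)).not_gt (Finset.sum_lt_sum (fun i hi => ?_) ⟨k, by simp, hk⟩)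
      rcases (Nat.lt_succ_iff.1 (Finset.mem_filter.1 hi).2).lt_or_eq with h1 | h1
      · exact h i h1
      · rw [Fin.ext h1]; exact hk.le
    set δ := min (M j j - a j) (a k - M k k) with hδ
    have hδj : δ ≤ M j j - a j := min_le_left _ _
    have hδk : δ ≤ a k - M k k := min_le_right _ _
    have hδ0 : 0 < δ := lt_min (by linarith) (by linarith)
    have hajk := ha hjk.le
    obtain ⟨U, hU, hUj, hUk, hUi⟩ := exists_rotation M hjk.ne (t := M j j - δ)
      (by linarith) (by linarith)
    have hne := hjk.ne
    have hdiag : ∀ i, (Uᵀ * M * U) i i =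
        M i i + ((if i = k then δ else 0) - if i = j then δ else 0) := by
      intro i
      by_cases h1 : i = j
      · subst h1; simp [hUj, hne, sub_eq_add_neg]
      by_cases h2 : i = k
      · subst h2; simp [hUk, h1]
      simp [hUi i h1 h2, h1, h2]
    have hcard : (Finset.univ.filter fun i => a i ≠ (Uᵀ * M * U) i i).card ≤ N := by
      refine Nat.lt_succ_iff.1 (lt_of_lt_of_le (Finset.card_lt_card ?_) hc)
      rw [Finset.ssubset_iff_of_subset]
      · rcases min_choice (M j j - a j) (a k - M k k) with h | h
        · exact ⟨j, by simpa using hj.ne, by simp [hUj, hδ, h]⟩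
        · refine ⟨k, by simpa using hk.ne', ?_⟩
          simp only [Finset.mem_filter, Finset.mem_univ, true_and, not_not, hUk, hδ, h]
          ring
      · intro i
        simp only [Finset.mem_filter, Finset.mem_univ, true_and]
        intro hi
        by_cases h1 : i = j
        · subst h1; exact hj.ne
        by_cases h2 : i = k
        · subst h2; exact hk.ne'
        rwa [hUi i h1 h2] at hi
    have hpartial : ∀ l : ℕ, ∑ i ∈ Finset.univ.filter (fun i : Fin n => (i : ℕ) < l), a i ≤
        ∑ i ∈ Finset.univ.filter (fun i : Fin n => (i : ℕ) < l), (Uᵀ * M * U) i i := by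
      intro l
      rcases le_or_gt l (k : ℕ) with hl | hl
      · refine Finset.sum_le_sum fun i hi => ?_
        have hik : i < k := (Finset.mem_filter.1 hi).2.trans_le hl
        have := hmin i hik
        rw [hdiag i, if_neg hik.ne]
        split_ifs with h
        · subst h; linarith
        · linarith
      · refine (hpre l).trans_eq ?_
        have hjl : (j : ℕ) < l := lt_trans hjk hl
        simp [hdiag, Finset.sum_add_distrib, hl, hjl]
    have htotal : ∑ i, a i = ∑ i, (Uᵀ * M * U) i i := by
      simp [hdiag, Finset.sum_add_distrib, htot]
    obtain ⟨V, hV, hVa⟩ := ih (Uᵀ * M * U) hcard hpartial htotal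
    refine ⟨U * V, ?_, fun i => ?_⟩
    · rw [transpose_mul, Matrix.mul_assoc, ← Matrix.mul_assoc Uᵀ, hU, Matrix.one_mul, hV]
    · rw [← hVa i, transpose_mul]
      simp only [Matrix.mul_assoc]

theorem isHermitian_idempotent_rank_vecMulVec {n : ℕ} {v : Fin n → ℂ} (hv : star v ⬝ᵥ v = 1) :
    (vecMulVec v (star v)).IsHermitian ∧
      vecMulVec v (star v) * vecMulVec v (star v) = vecMulVec v (star v) ∧
      (vecMulVec v (star v)).rank = 1 := by
  refine ⟨by simp [IsHermitian, conjTranspose_vecMulVec], by simp [vecMulVec_mul_vecMulVec, hv], ?_⟩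
  refine le_antisymm (rank_vecMulVec_le _ _) (Nat.one_le_iff_ne_zero.2 fun h => ?_)
  have h0 := LinearMap.range_eq_bot.1 (Submodule.finrank_eq_zero.1 h)
  have h1 : vecMulVec v (star v) *ᵥ v = v := by simp [vecMulVec_mulVec, hv]
  rw [← mulVecLin_apply, h0, LinearMap.zero_apply] at h1
  simp [← h1] at hv

theorem exists_factor_of_majorizes {n : ℕ} {a b : Fin n → ℝ} (hb : ∀ i, 0 ≤ b i)
    (h : Majorizes a b) :
    ∃ X : Matrix (Fin n) (Fin n) ℝ, X * Xᵀ = diagonal b ∧ ∀ i, ∑ p, X p i * X p i = a i := by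
  obtain ⟨σ, hσ⟩ := exists_perm_sortedVec a
  obtain ⟨τ, hτ⟩ := exists_perm_sortedVec b
  have htot : ∑ i, sortedVec a i = ∑ i, sortedVec b i := by
    simp only [hσ, hτ]
    rw [Equiv.sum_comp σ a, Equiv.sum_comp τ b, h.2]
  obtain ⟨V, hV, hVa⟩ := exists_orthogonal_diag_eq (sortedVec a) (sortedVec_antitone a) _
    (diagonal (sortedVec b)) le_rfl
    (fun l => by
      simp only [diagonal_apply_eq]
      rcases le_or_gt l n with hl | hl
      · exact h.1 l hl
      · have : ∀ i : Fin n, (i : ℕ) < l := fun i => i.2.trans hl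
        simpa [this] using htot.le)
    (by simpa using htot)
  have hV' : V * Vᵀ = 1 := mul_eq_one_comm.1 hV
  refine ⟨of fun p i => √(b p) * V (τ.symm p) (σ.symm i), ?_, fun i => ?_⟩
  · ext p q
    have hpq := congrFun (congrFun hV' (τ.symm p)) (τ.symm q)
    rw [mul_apply, ← Equiv.sum_comp σ.symm] at hpq
    simp only [transpose_apply] at hpq
    have : ∀ i, √(b p) * V (τ.symm p) (σ.symm i) * (√(b q) * V (τ.symm q) (σ.symm i)) =
        √(b p) * √(b q) * (V (τ.symm p) (σ.symm i) * V (τ.symm q) (σ.symm i)) := fun i => by ring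
    simp only [mul_apply, transpose_apply, of_apply, this]
    rw [← Finset.mul_sum, hpq]
    by_cases hpq : p = q
    · subst hpq; simp [Real.mul_self_sqrt (hb p)]
    · simp [hpq]
  · have hi := hVa (σ.symm i)
    rw [hσ, Equiv.apply_symm_apply] at hi
    rw [← hi, mul_apply, ← Equiv.sum_comp τ]
    refine Finset.sum_congr rfl fun q _ => ?_
    have := Real.mul_self_sqrt (hb (τ q))
    simp only [of_apply, Equiv.symm_apply_apply, mul_diagonal, transpose_apply, hτ]
    linear_combination V q (σ.symm i) ^ 2 * this

theorem majorizes_of_factor {n : ℕ} {a b : Fin n → ℝ} (hb : ∀ i, 0 ≤ b i)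
    {X : Matrix (Fin n) (Fin n) ℂ} (hX : X * Xᴴ = diagonal fun i => (b i : ℂ))
    (hXa : ∀ i, ∑ p, Complex.normSq (X p i) = a i) : Majorizes a b := by
  have hrow : ∀ p, ∑ i, Complex.normSq (X p i) = b p := fun p => by
    have := congrFun (congrFun hX p) p
    simp only [mul_apply, conjTranspose_apply, Complex.star_def, Complex.mul_conj,
      diagonal_apply_eq] at this
    exact_mod_cast this
  let W : Matrix (Fin n) (Fin n) ℂ := diagonal (fun p => (((√(b p))⁻¹ : ℝ) : ℂ)) * X
  have hXW : ∀ p i, Complex.normSq (X p i) = b p * Complex.normSq (W p i) := fun p i => by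
    rcases (hb p).eq_or_lt with h0 | h0
    · have := (Finset.sum_eq_zero_iff_of_nonneg fun i _ => Complex.normSq_nonneg (X p i)).1
        ((hrow p).trans h0.symm) i (Finset.mem_univ i)
      rw [this, ← h0, zero_mul]
    · have := Real.mul_self_sqrt h0.le
      have := (Real.sqrt_pos.2 h0).ne'
      simp only [W, diagonal_mul, map_mul, Complex.normSq_ofReal]
      field_simp
      rw [Real.sq_sqrt h0.le, mul_comm]
  have hWW : W * Wᴴ = diagonal fun p => if b p = 0 then 0 else 1 := by
    have : W * Wᴴ = diagonal (fun p => (((√(b p))⁻¹ : ℝ) : ℂ)) * (X * Xᴴ) *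
        diagonal (fun p => (((√(b p))⁻¹ : ℝ) : ℂ)) := by
      simp only [W, conjTranspose_mul, diagonal_conjTranspose, Matrix.mul_assoc]
      congr 4
      ext p; simp
    rw [this, hX, diagonal_mul_diagonal, diagonal_mul_diagonal]
    congr 1
    ext p
    split_ifs with h0
    · simp [h0]
    · have h1 : (√(b p))⁻¹ * b p * (√(b p))⁻¹ = 1 := by
        have := (Real.sqrt_pos.2 ((hb p).lt_of_ne' h0)).ne'
        field_simp
        rw [Real.sq_sqrt (hb p)]
      exact_mod_cast h1
  have hWrow : ∀ p, ∑ i, Complex.normSq (W p i) ≤ 1 := fun p => by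
    have := congrFun (congrFun hWW p) p
    simp only [mul_apply, conjTranspose_apply, Complex.star_def, Complex.mul_conj,
      diagonal_apply_eq] at this
    have h2 : ∑ i, Complex.normSq (W p i) = if b p = 0 then 0 else 1 := by
      split_ifs at this ⊢ <;> exact_mod_cast this
    rw [h2]; split_ifs <;> norm_num
  have hWcol : ∀ i, ∑ p, Complex.normSq (W p i) ≤ 1 := fun i => by
    have hEW : W * Wᴴ * W = W := by
      rw [hWW]
      ext p q
      rw [diagonal_mul]
      split_ifs with h0
      · simp [W, h0]
      · simp
    have hH : (Wᴴ * W) * (Wᴴ * W)ᴴ = Wᴴ * W := by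
      rw [(isHermitian_conjTranspose_mul_self W).eq, Matrix.mul_assoc, ← Matrix.mul_assoc W, hEW]
    set c := ∑ p, Complex.normSq (W p i) with hc
    have hHi : (Wᴴ * W) i i = (c : ℂ) := by
      simp [mul_apply, hc, Complex.normSq_eq_conj_mul_self]
    have h1 := congrFun (congrFun hH i) i
    rw [mul_apply, hHi] at h1
    simp only [conjTranspose_apply, Complex.star_def, Complex.mul_conj] at h1
    have h2 : ∑ j, Complex.normSq ((Wᴴ * W) i j) = c := by exact_mod_cast h1
    have h3 := Finset.single_le_sum (fun j _ => Complex.normSq_nonneg ((Wᴴ * W) i j))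
      (Finset.mem_univ i)
    rw [h2, hHi, Complex.normSq_ofReal] at h3
    nlinarith
  obtain ⟨σ, hσ⟩ := exists_perm_sortedVec a
  obtain ⟨τ, hτ⟩ := exists_perm_sortedVec b
  refine ⟨fun k hk => ?_, ?_⟩
  · have hcard : (Finset.univ.filter (fun i : Fin n => (i : ℕ) < k)).card = k := by
      simp [Fin.card_filter_val_lt, hk]
    have hsum : ∑ i ∈ Finset.univ.filter (fun i : Fin n => (i : ℕ) < k), sortedVec a i =
        ∑ q, sortedVec b q * ∑ i ∈ Finset.univ.filter (fun i : Fin n => (i : ℕ) < k),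
          Complex.normSq (W (τ q) (σ i)) := by
      simp only [Finset.mul_sum]
      rw [Finset.sum_comm]
      refine Finset.sum_congr rfl fun i _ => ?_
      rw [hσ, ← hXa, ← Equiv.sum_comp τ]
      simp only [hXW, hτ]
    rw [hsum]
    refine sum_mul_le_partial_sum _ _ k hk (sortedVec_antitone b) (fun i => hτ i ▸ hb _)
      (fun q => Finset.sum_nonneg fun i _ => Complex.normSq_nonneg _) (fun q => ?_) ?_
    · refine (Finset.sum_le_univ_sum_of_nonneg fun i => Complex.normSq_nonneg _).trans ?_
      rw [Equiv.sum_comp σ fun i => Complex.normSq (W (τ q) i)]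
      exact hWrow _
    · rw [Finset.sum_comm]
      calc _ ≤ ∑ i ∈ Finset.univ.filter (fun i : Fin n => (i : ℕ) < k), (1 : ℝ) := by
            refine Finset.sum_le_sum fun i _ => ?_
            rw [Equiv.sum_comp τ fun p => Complex.normSq (W p (σ i))]
            exact hWcol _
        _ = k := by simp [hcard]
  · simp only [← hXa, ← hrow]
    exact Finset.sum_comm

/-- a Schur–Horn/Horn-lemma variant: for nonnegative
vectors `a, b ∈ ℝ^n`, `Diag(b) = Σ_i a_i Q_i` for some rank-one orthogonal
projections `Q_i` if and only if `a ≺ b`. -/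
theorem stmt_19 {n : ℕ} (a b : Fin n → ℝ)
    (ha : ∀ i, 0 ≤ a i) (hb : ∀ i, 0 ≤ b i) :
    (∃ Q : Fin n → Matrix (Fin n) (Fin n) ℂ,
        (∀ i, (Q i).IsHermitian ∧ Q i * Q i = Q i ∧ (Q i).rank = 1) ∧
        Matrix.diagonal (fun i => (b i : ℂ)) = ∑ i : Fin n, (a i : ℂ) • Q i) ↔
      Majorizes a b := by
  constructor
  · rintro ⟨Q, hQ, hsum⟩
    choose v hv hv1 using fun i =>
      exists_eq_vecMulVec_of_rank_one (Q i) (hQ i).1 (hQ i).2.1 (hQ i).2.2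
    refine majorizes_of_factor hb (X := of fun p i => ((√(a i) : ℝ) : ℂ) * v i p) ?_ fun i => ?_
    · rw [hsum]
      ext p q
      simp only [mul_apply, of_apply, conjTranspose_apply, Matrix.sum_apply, Matrix.smul_apply,
        smul_eq_mul]
      refine Finset.sum_congr rfl fun i _ => ?_
      have h : ((√(a i) : ℝ) : ℂ) * (√(a i) : ℝ) = a i := by
        rw [← Complex.ofReal_mul, Real.mul_self_sqrt (ha i)]
      rw [hv i, vecMulVec_apply, star_mul', Complex.star_def, Complex.conj_ofReal, Pi.star_apply,
        Complex.star_def, ← h]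
      ring
    · have h : ∑ p, Complex.normSq (v i p) = 1 := by
        have := hv1 i
        simp only [dotProduct, Pi.star_apply, Complex.star_def,
          ← Complex.normSq_eq_conj_mul_self] at this
        exact_mod_cast this
      simp only [of_apply, map_mul, Complex.normSq_ofReal, Real.mul_self_sqrt (ha i)]
      rw [← Finset.mul_sum, h, mul_one]
  · intro h
    obtain ⟨X, hX, hXa⟩ := exists_factor_of_majorizes hb h
    let w : Fin n → Fin n → ℝ := fun i =>
      if a i = 0 then Pi.single i 1 else fun p => X p i / √(a i)
    have hw1 : ∀ i, ∑ p, w i p * w i p = 1 := fun i => by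
      by_cases h0 : a i = 0
      · simp [w, h0, Pi.single_apply]
      · simp only [w, if_neg h0, div_mul_div_comm, Real.mul_self_sqrt (ha i)]
        rw [← Finset.sum_div, hXa, div_self h0]
    have hwX : ∀ i p q, a i * (w i p * w i q) = X p i * X q i := fun i p q => by
      by_cases h0 : a i = 0
      · have hz := (Finset.sum_eq_zero_iff_of_nonneg fun p _ => mul_self_nonneg (X p i)).1
          ((hXa i).trans h0) p (Finset.mem_univ p)
        rw [h0, mul_self_eq_zero.1 hz, zero_mul, zero_mul]
      · simp only [w, if_neg h0, div_mul_div_comm, Real.mul_self_sqrt (ha i)]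
        field_simp
    refine ⟨fun i => vecMulVec (fun p => (w i p : ℂ)) (star fun p => (w i p : ℂ)),
      fun i => isHermitian_idempotent_rank_vecMulVec ?_, ?_⟩
    · simp only [dotProduct, Pi.star_apply, Complex.star_def, Complex.conj_ofReal]
      exact_mod_cast hw1 i
    · ext p q
      have hpq := congrFun (congrFun hX p) q
      simp only [Matrix.sum_apply, Matrix.smul_apply, vecMulVec_apply, Pi.star_apply,
        Complex.star_def, Complex.conj_ofReal, smul_eq_mul]
      have : ∀ i, (a i : ℂ) * (w i p * w i q) = ((X p i * X q i : ℝ) : ℂ) := fun i => by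
        rw [← hwX]; push_cast; ring
      simp only [this]
      rw [← Complex.ofReal_sum]
      have h2 : ∑ i, X p i * X q i = diagonal b p q := by
        rw [← hpq, mul_apply]; rfl
      rw [h2, diagonal_apply, diagonal_apply]
      split_ifs <;> simp
end
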